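/- arXiv:1509.05707 — 2 statements merged into one kernel-verified Lean document; each statement's English description precedes it below -/
import Mathlib

section
/- Let F be a finite field of characteristic p with q = |F| elements, let f ∈ F[x_1,…,x_d] be a reduced polynomial (every exponent occurring in f is less than q) with f(0) = 0, let α : F^d → F be its evaluation function, and let n ≥ 1. Then α is an n-application (i.e., α(a·u) = a^n·α(u) for all a ∈ F, u ∈ F^d, and Δ^n α is a symmetric n-linear form) if and only if the following three conditions hold: every monomial of f has p-degree at most n; every monomial of f whose p-degree equals n is totally reduced (all exponents less than p); and every monomial of f has positive total degree congruent to n modulo q − 1. -/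
open MvPolynomial Finset Function

/-- The `n`-th defect of a function `α : V → F`:
`Δ^n α(u_1,…,u_n) = Σ_{∅ ≠ S ⊆ {1,…,n}} (−1)^{n−|S|} α(Σ_{i∈S} u_i)`. -/
def fnDefect {F V : Type*} [Field F] [AddCommGroup V] (α : V → F) (n : ℕ)
    (u : Fin n → V) : F :=
  ∑ S ∈ Finset.univ.powerset.filter (fun S : Finset (Fin n) => S.Nonempty),
    (-1 : F) ^ (n - S.card) * α (∑ i ∈ S, u i)

/-- The `p`-weight of a natural number: the sum of its base-`p` digits. -/
def pWeight (p t : ℕ) : ℕ := if p = 0 then t else (Nat.digits p t).sum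

/-! ### Digit sums -/

theorem pWeight_eq_digits_sum {p : ℕ} (hp : p.Prime) (t : ℕ) :
    pWeight p t = (Nat.digits p t).sum :=
  if_neg hp.ne_zero

theorem pWeight_zero (p : ℕ) : pWeight p 0 = 0 := by
  simp [pWeight]

theorem pWeight_eq_mod_add_div {p : ℕ} (hp : p.Prime) (t : ℕ) :
    pWeight p t = t % p + pWeight p (t / p) := by
  rcases Nat.eq_zero_or_pos t with rfl | ht
  · simp [pWeight_zero]
  · rw [pWeight_eq_digits_sum hp, pWeight_eq_digits_sum hp, Nat.digits_def' hp.one_lt ht,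
      List.sum_cons]

theorem pWeight_le {p : ℕ} (hp : p.Prime) (t : ℕ) : pWeight p t ≤ t := by
  rw [pWeight_eq_digits_sum hp]
  exact Nat.digit_sum_le p t

theorem pWeight_eq_self_iff {p : ℕ} (hp : p.Prime) (t : ℕ) : pWeight p t = t ↔ t < p := by
  constructor
  · intro h
    by_contra! hlt
    have h1 : 1 ≤ t / p := Nat.div_pos hlt hp.pos
    have h2 := pWeight_eq_mod_add_div hp t
    have h3 := pWeight_le hp (t / p)
    have h4 := Nat.mod_add_div t p
    nlinarith [hp.two_le]
  · intro h
    rw [pWeight_eq_mod_add_div hp, Nat.mod_eq_of_lt h, Nat.div_eq_of_lt h, pWeight_zero, add_zero]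

theorem pWeight_pos {p : ℕ} (hp : p.Prime) {t : ℕ} (ht : 0 < t) : 0 < pWeight p t := by
  induction t using Nat.strong_induction_on with
  | _ t ih =>
    rcases lt_or_ge t p with h | h
    · rwa [(pWeight_eq_self_iff hp t).2 h]
    · rw [pWeight_eq_mod_add_div hp]
      have := ih (t / p) (Nat.div_lt_self ht hp.one_lt) (Nat.div_pos h hp.pos)
      omega

theorem exists_pWeight_add_one {p : ℕ} (hp : p.Prime) {t : ℕ} (ht : 0 < t) :
    ∃ s a, t = s + a ∧ 0 < a ∧ pWeight p a = 1 ∧ pWeight p t = pWeight p s + 1 := by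
  induction t using Nat.strong_induction_on with
  | _ t ih =>
    rcases lt_or_ge t p with h | h
    · refine ⟨t - 1, 1, by omega, one_pos, (pWeight_eq_self_iff hp 1).2 hp.one_lt, ?_⟩
      rw [(pWeight_eq_self_iff hp t).2 h, (pWeight_eq_self_iff hp (t - 1)).2 (by omega)]
      omega
    · obtain ⟨s, a, hsa, ha, ha1, hw⟩ :=
        ih (t / p) (Nat.div_lt_self ht hp.one_lt) (Nat.div_pos h hp.pos)
      refine ⟨t % p + p * s, p * a, ?_, Nat.mul_pos hp.pos ha, ?_, ?_⟩
      · rw [add_assoc, ← mul_add, ← hsa, Nat.mod_add_div]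
      · rw [pWeight_eq_mod_add_div hp, Nat.mul_mod_right, Nat.mul_div_cancel_left _ hp.pos, ha1]
      · rw [pWeight_eq_mod_add_div hp t, pWeight_eq_mod_add_div hp (t % p + p * s),
          Nat.add_mul_mod_self_left, Nat.mod_mod, Nat.add_mul_div_left _ _ hp.pos,
          Nat.div_eq_of_lt (Nat.mod_lt t hp.pos), zero_add, hw, add_assoc]

/-- A vector of `p`-degree at least `n ≥ 1` is a carry-free sum of `n` nonzero vectors. -/
theorem exists_carryFree_decomposition {p : ℕ} (hp : p.Prime) {d : ℕ} (n : ℕ) (m : Fin d → ℕ)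
    (hm : n + 1 ≤ ∑ j, pWeight p (m j)) :
    ∃ k : Fin (n + 1) → Fin d → ℕ, (∀ j, ∑ i, k i j = m j) ∧ (∀ i, ∑ j, k i j ≠ 0) ∧
      ∀ j, ∑ i, pWeight p (k i j) = pWeight p (m j) := by
  induction n generalizing m with
  | zero =>
    refine ⟨fun _ => m, by simp, fun _ h => ?_, by simp⟩
    rw [Finset.sum_eq_zero_iff] at h
    rw [Finset.sum_eq_zero fun j hj => by rw [show m j = 0 from h j hj, pWeight_zero]] at hm
    omega
  | succ n ih =>
    obtain ⟨j, -, hj⟩ := Finset.exists_ne_zero_of_sum_ne_zero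
      (show ∑ j, pWeight p (m j) ≠ 0 by omega)
    have hmj : 0 < m j := Nat.pos_of_ne_zero fun h => hj (by rw [h, pWeight_zero])
    obtain ⟨s, a, hsa, ha, ha1, hw⟩ := exists_pWeight_add_one hp hmj
    have hupd : ∀ l, pWeight p (m l) =
        pWeight p (update m j s l) + pWeight p ((Pi.single j a : Fin d → ℕ) l) := by
      intro l
      rcases eq_or_ne l j with rfl | hl
      · rw [update_self, Pi.single_eq_same, hw, ha1]
      · rw [update_of_ne hl, Pi.single_eq_of_ne hl, pWeight_zero, add_zero]
    have hsingle : ∑ l, pWeight p ((Pi.single j a : Fin d → ℕ) l) = 1 := by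
      rw [Finset.sum_eq_single j (fun l _ hl => by rw [Pi.single_eq_of_ne hl, pWeight_zero])
        (by simp), Pi.single_eq_same, ha1]
    obtain ⟨k, hk1, hk2, hk3⟩ := ih (update m j s) (by
      simp_rw [hupd, Finset.sum_add_distrib, hsingle] at hm
      omega)
    refine ⟨Fin.cons (Pi.single j a) k, fun l => ?_, fun i => ?_, fun l => ?_⟩
    · rw [Fin.sum_univ_succ]
      simp only [Fin.cons_zero, Fin.cons_succ, hk1]
      rcases eq_or_ne l j with rfl | hl
      · rw [update_self, Pi.single_eq_same, hsa, add_comm]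
      · rw [update_of_ne hl, Pi.single_eq_of_ne hl, zero_add]
    · refine Fin.cases ?_ (fun i => ?_) i
      · simpa using ha.ne'
      · simpa only [Fin.cons_succ] using hk2 i
    · rw [Fin.sum_univ_succ]
      simp only [Fin.cons_zero, Fin.cons_succ, hk3]
      rw [hupd l, add_comm]

theorem sub_one_mul_padicValNat_prod_factorial {p : ℕ} (hp : p.Prime) {ι : Type*} (s : Finset ι)
    (k : ι → ℕ) :
    (p - 1) * padicValNat p (∏ i ∈ s, (k i).factorial) + ∑ i ∈ s, pWeight p (k i) =
      ∑ i ∈ s, k i := by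
  classical
  have := Fact.mk hp
  induction s using Finset.induction_on with
  | empty => simp
  | insert a s ha ih =>
    rw [Finset.prod_insert ha, Finset.sum_insert ha, Finset.sum_insert ha,
      padicValNat.mul (Nat.factorial_ne_zero _)
        (Finset.prod_ne_zero_iff.2 fun i _ => Nat.factorial_ne_zero _), mul_add,
      sub_one_mul_padicValNat_factorial, ← pWeight_eq_digits_sum hp]
    have := pWeight_le hp (k a)
    omega

/-- A multinomial coefficient is prime to `p` iff there are no carries in base `p`. -/
theorem multinomial_cast_ne_zero_iff {F : Type*} [Field F] {p : ℕ} [CharP F p] (hp : p.Prime)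
    {ι : Type*} (s : Finset ι) (k : ι → ℕ) :
    (Nat.multinomial s k : F) ≠ 0 ↔ ∑ i ∈ s, pWeight p (k i) = pWeight p (∑ i ∈ s, k i) := by
  have := Fact.mk hp
  have h1 := sub_one_mul_padicValNat_prod_factorial hp s k
  have h2 := sub_one_mul_padicValNat_factorial (p := p) (∑ i ∈ s, k i)
  have hne : Nat.multinomial s k ≠ 0 := (Nat.multinomial_pos s k).ne'
  rw [← Nat.multinomial_spec, padicValNat.mul
    (Finset.prod_ne_zero_iff.2 fun i _ => Nat.factorial_ne_zero _) hne, mul_add,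
    ← pWeight_eq_digits_sum hp] at h2
  have h3 := pWeight_le hp (∑ i ∈ s, k i)
  rw [Ne, CharP.cast_eq_zero_iff F p, dvd_iff_padicValNat_ne_zero hne, not_not]
  have h4 : (p - 1) * padicValNat p (Nat.multinomial s k) = 0 ↔
      padicValNat p (Nat.multinomial s k) = 0 := by
    have := hp.one_lt
    rw [mul_eq_zero]
    omega
  rw [← h4]
  omega

/-! ### The defect of a polynomial function as a polynomial -/

/-- The exponent vector with entry `K j i` at the variable `(j, i)`. -/
noncomputable def uncurriedExponent {d n : ℕ} (K : Fin d → Fin n → ℕ) : Fin d × Fin n →₀ ℕ :=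
  Finsupp.equivFunOnFinite.symm fun x => K x.1 x.2

theorem uncurriedExponent_apply {d n : ℕ} (K : Fin d → Fin n → ℕ) (x : Fin d × Fin n) :
    uncurriedExponent K x = K x.1 x.2 :=
  rfl

theorem uncurriedExponent_injective {d n : ℕ} :
    Injective (uncurriedExponent : (Fin d → Fin n → ℕ) → _) := fun K L h => by
  funext j i
  exact DFunLike.congr_fun h (j, i)

/-- The factor by which the coefficient of `x^m` is multiplied in the defect, at the monomial
with exponents `K j i` such that `∑ i, K j i = m j`. -/
def defectFactor (F : Type*) [Field F] {d n : ℕ} (K : Fin d → Fin n → ℕ) : F :=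
  (∏ j, (Nat.multinomial univ (K j) : F)) * ∏ i, (1 - 0 ^ ∑ j, K j i)

/-- The polynomial in `n` generic vectors whose evaluation function is the `n`-th defect. -/
noncomputable def defectPoly {F : Type*} [Field F] {d : ℕ} (f : MvPolynomial (Fin d) F) (n : ℕ) :
    MvPolynomial (Fin d × Fin n) F :=
  ∑ m ∈ f.support, ∑ K ∈ Fintype.piFinset fun j => (univ : Finset (Fin n)).piAntidiag (m j),
    monomial (uncurriedExponent K) (coeff m f * defectFactor F K)

theorem sum_powerset_prod_indicator_pow {F : Type*} [Field F] {n : ℕ} (e : Fin n → ℕ) :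
    ∑ S ∈ (univ : Finset (Fin n)).powerset,
      (-1 : F) ^ (n - S.card) * ∏ i, (if i ∈ S then 1 else 0) ^ e i = ∏ i, (1 - 0 ^ e i) := by
  simp_rw [sub_eq_add_neg, Finset.prod_add]
  refine Finset.sum_congr rfl fun S _ => ?_
  rw [Finset.prod_const_one, one_mul, Finset.prod_neg, ← Finset.compl_eq_univ_sdiff,
    Finset.card_compl, Fintype.card_fin,
    ← Finset.prod_mul_prod_compl S fun i => (if i ∈ S then (1 : F) else 0) ^ e i,
    Finset.prod_congr rfl fun i hi => by rw [if_pos hi, one_pow], Finset.prod_const_one, one_mul]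
  congr 1
  exact Finset.prod_congr rfl fun i hi => by rw [if_neg (Finset.mem_compl.1 hi)]

theorem sum_powerset_prod_sum_pow {F : Type*} [Field F] {d n : ℕ} (m : Fin d → ℕ)
    (u : Fin n → Fin d → F) :
    ∑ S ∈ (univ : Finset (Fin n)).powerset,
      (-1 : F) ^ (n - S.card) * ∏ j, (∑ i ∈ S, u i) j ^ m j =
    ∑ K ∈ Fintype.piFinset fun j => (univ : Finset (Fin n)).piAntidiag (m j),
      defectFactor F K * ∏ j, ∏ i, u i j ^ K j i := by
  have key : ∀ S : Finset (Fin n), ∏ j, (∑ i ∈ S, u i) j ^ m j =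
      ∑ K ∈ Fintype.piFinset fun j => (univ : Finset (Fin n)).piAntidiag (m j),
        (∏ j, (Nat.multinomial univ (K j) : F)) * (∏ j, ∏ i, u i j ^ K j i) *
          ∏ i, (if i ∈ S then 1 else 0) ^ ∑ j, K j i := by
    intro S
    have h : ∀ j, (∑ i ∈ S, u i) j = ∑ i, (if i ∈ S then 1 else 0) * u i j := by
      intro j
      simp [Finset.sum_apply, ite_mul]
    simp_rw [h, Finset.sum_pow_eq_sum_piAntidiag, Finset.prod_univ_sum]
    refine Finset.sum_congr rfl fun K _ => ?_
    simp_rw [mul_pow, Finset.prod_mul_distrib, ← Finset.prod_pow_eq_pow_sum]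
    rw [Finset.prod_comm (f := fun j i => (if i ∈ S then (1 : F) else 0) ^ K j i)]
    ring
  simp_rw [key, Finset.mul_sum]
  rw [Finset.sum_comm]
  refine Finset.sum_congr rfl fun K _ => ?_
  rw [defectFactor, ← sum_powerset_prod_indicator_pow, Finset.mul_sum, Finset.sum_mul]
  exact Finset.sum_congr rfl fun S _ => by ring

theorem fnDefect_eval {F : Type*} [Field F] {d : ℕ} (f : MvPolynomial (Fin d) F)
    (h0 : constantCoeff f = 0) (n : ℕ) (u : Fin n → Fin d → F) :
    fnDefect (fun a => eval a f) n u =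
      ∑ m ∈ f.support, ∑ K ∈ Fintype.piFinset fun j => (univ : Finset (Fin n)).piAntidiag (m j),
        coeff m f * defectFactor F K * ∏ j, ∏ i, u i j ^ K j i := by
  have h : fnDefect (fun a => eval a f) n u = ∑ S ∈ (univ : Finset (Fin n)).powerset,
      (-1 : F) ^ (n - S.card) * eval (∑ i ∈ S, u i) f := by
    refine Finset.sum_filter_of_ne fun S _ hS => ?_
    rw [Finset.nonempty_iff_ne_empty]
    rintro rfl
    apply hS
    simp [eval_zero, h0]
  simp_rw [h, eval_eq', Finset.mul_sum]
  rw [Finset.sum_comm]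
  refine Finset.sum_congr rfl fun m _ => ?_
  simp_rw [mul_assoc, ← Finset.mul_sum, ← sum_powerset_prod_sum_pow, Finset.mul_sum]
  exact Finset.sum_congr rfl fun S _ => by ring

theorem eval_defectPoly {F : Type*} [Field F] {d : ℕ} (f : MvPolynomial (Fin d) F)
    (h0 : constantCoeff f = 0) (n : ℕ) (v : Fin d × Fin n → F) :
    eval v (defectPoly f n) = fnDefect (fun a => eval a f) n fun i j => v (j, i) := by
  rw [fnDefect_eval f h0, defectPoly]
  simp only [map_sum]
  refine Finset.sum_congr rfl fun m _ => Finset.sum_congr rfl fun K _ => ?_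
  rw [eval_monomial, Finsupp.prod_fintype _ _ fun _ => pow_zero _, Fintype.prod_prod_type]
  rfl

theorem coeff_defectPoly {F : Type*} [Field F] {d : ℕ} (f : MvPolynomial (Fin d) F) {n : ℕ}
    {m : Fin d →₀ ℕ} (hm : m ∈ f.support) {K : Fin d → Fin n → ℕ} (hK : ∀ j, ∑ i, K j i = m j) :
    coeff (uncurriedExponent K) (defectPoly f n) = coeff m f * defectFactor F K := by
  simp only [defectPoly, coeff_sum, coeff_monomial]
  rw [Finset.sum_eq_single m, Finset.sum_eq_single K]
  · rw [if_pos rfl]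
  · intro L _ hL
    rw [if_neg (uncurriedExponent_injective.ne hL)]
  · intro h
    exact absurd (Fintype.mem_piFinset.2 fun j => Finset.mem_piAntidiag.2 ⟨hK j, by simp⟩) h
  · intro l _ hl
    refine Finset.sum_eq_zero fun L hL => if_neg ?_
    rintro h
    obtain rfl := uncurriedExponent_injective h
    refine hl (Finsupp.ext fun j => ?_)
    rw [← hK j, ← (Finset.mem_piAntidiag.1 (Fintype.mem_piFinset.1 hL j)).1]
  · exact fun h => absurd hm h

theorem defectFactor_ne_zero_iff {F : Type*} [Field F] {p : ℕ} [CharP F p] (hp : p.Prime)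
    {d n : ℕ} (K : Fin d → Fin n → ℕ) :
    defectFactor F K ≠ 0 ↔ (∀ j, ∑ i, pWeight p (K j i) = pWeight p (∑ i, K j i)) ∧
      ∀ i, ∑ j, K j i ≠ 0 := by
  rw [defectFactor, mul_ne_zero_iff, Finset.prod_ne_zero_iff, Finset.prod_ne_zero_iff]
  simp only [Finset.mem_univ, true_implies, multinomial_cast_ne_zero_iff hp]
  refine and_congr_right' (forall_congr' fun i => not_congr ?_)
  by_cases h : ∑ j, K j i = 0
  · rw [h]; simp
  · rw [zero_pow h]; simpa using h

/-! ### Reduced polynomials over finite fields -/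

theorem eq_zero_of_reduced_of_eval_eq_zero {F σ : Type*} [Field F] [Fintype F] [Finite σ]
    (P : MvPolynomial σ F) (hP : P ∈ restrictDegree σ F (Fintype.card F - 1))
    (h : ∀ v, eval v P = 0) : P = 0 := by
  refine eq_zero_of_eval_zero_at_prod_finset P (fun _ => univ) (fun i => ?_) fun v _ => h v
  rw [degreeOf_eq_sup, Finset.card_univ, Finset.sup_lt_iff Fintype.card_pos]
  intro s hs
  have := (mem_restrictDegree _ _ _).1 hP s hs i
  have := Fintype.card_pos (α := F)
  omega

theorem monomial_mem_restrictDegree {F σ : Type*} [Field F] {N : ℕ} {s : σ →₀ ℕ}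
    (hs : ∀ i, s i ≤ N) (c : F) : monomial s c ∈ restrictDegree σ F N := by
  classical
  rw [mem_restrictDegree]
  intro t ht i
  rw [Finset.mem_singleton.1 (support_monomial_subset ht)]
  exact hs i

theorem defectPoly_mem_restrictDegree {F : Type*} [Field F] {d N : ℕ}
    {f : MvPolynomial (Fin d) F} (hf : ∀ m ∈ f.support, ∀ j, m j ≤ N) (n : ℕ) :
    defectPoly f n ∈ restrictDegree (Fin d × Fin n) F N := by
  refine Submodule.sum_mem _ fun m hm => Submodule.sum_mem _ fun K hK =>
    monomial_mem_restrictDegree (fun x => ?_) _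
  refine le_trans ?_ (hf m hm x.1)
  rw [uncurriedExponent_apply, ← (Finset.mem_piAntidiag.1 (Fintype.mem_piFinset.1 hK x.1)).1]
  exact Finset.single_le_sum (f := K x.1) (fun _ _ => Nat.zero_le _) (Finset.mem_univ x.2)

/-- If the `n`-th defect of a reduced polynomial is multilinear, then every monomial of
`defectPoly f n` has degree one in each of the `n` generic vectors. -/
theorem sum_eq_one_of_multilinear {F : Type*} [Field F] [Fintype F] {d : ℕ}
    (f : MvPolynomial (Fin d) F) (hred : ∀ m ∈ f.support, ∀ j, m j < Fintype.card F)
    (h0 : constantCoeff f = 0) {n : ℕ}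
    (M : MultilinearMap F (fun _ : Fin n => Fin d → F) F)
    (hM : ∀ u, fnDefect (fun a => eval a f) n u = M u) (K : Fin d → Fin n → ℕ)
    (hK : coeff (uncurriedExponent K) (defectPoly f n) ≠ 0) (i : Fin n) : ∑ j, K j i = 1 := by
  let e (J : Fin n → Fin d) : Fin d → Fin n → ℕ := fun j i => if J i = j then 1 else 0
  let Q : MvPolynomial (Fin d × Fin n) F :=
    ∑ J : Fin n → Fin d, monomial (uncurriedExponent (e J)) (M fun i => Pi.single (J i) 1)
  have hQ : ∀ v, eval v Q = M fun i j => v (j, i) := by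
    intro v
    have h1 : (fun (i : Fin n) (j : Fin d) => v (j, i)) =
        fun i => ∑ j, v (j, i) • (Pi.single j 1 : Fin d → F) := by
      funext i
      exact pi_eq_sum_univ' _
    rw [h1, MultilinearMap.map_sum, map_sum]
    refine Finset.sum_congr rfl fun J _ => ?_
    rw [M.map_smul_univ (fun i => v (J i, i)) fun i => Pi.single (J i) 1, eval_monomial,
      Finsupp.prod_fintype _ _ fun _ => pow_zero _, Fintype.prod_prod_type_right, smul_eq_mul,
      mul_comm]
    congr 1
    refine Finset.prod_congr rfl fun i _ => ?_
    simp [uncurriedExponent_apply, e, pow_ite]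
  have hcard : 1 ≤ Fintype.card F - 1 := by
    have := Fintype.one_lt_card (α := F)
    omega
  have hPQ : defectPoly f n = Q := by
    refine sub_eq_zero.1 (eq_zero_of_reduced_of_eval_eq_zero _ (Submodule.sub_mem _
      (defectPoly_mem_restrictDegree (fun m hm j => Nat.le_sub_one_of_lt (hred m hm j)) n)
      (Submodule.sum_mem _ fun J _ => monomial_mem_restrictDegree (fun x => ?_) _)) fun v => ?_)
    · refine le_trans ?_ hcard
      rw [uncurriedExponent_apply]
      simp only [e]
      split_ifs <;> simp
    · rw [map_sub, hQ, eval_defectPoly f h0, hM, sub_self]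
  rw [hPQ, coeff_sum] at hK
  obtain ⟨J, -, hJ⟩ := Finset.exists_ne_zero_of_sum_ne_zero hK
  rw [coeff_monomial] at hJ
  have hJK := uncurriedExponent_injective (of_not_not fun h => hJ (if_neg h))
  rw [← hJK]
  simp [e]

theorem exists_multilinearMap_prod_pow {F : Type*} [Field F] {d n : ℕ} (K : Fin d → Fin n → ℕ)
    (hK : ∀ i, ∑ j, K j i = 1) :
    ∃ M : MultilinearMap F (fun _ : Fin n => Fin d → F) F,
      ∀ u, M u = ∏ j, ∏ i, u i j ^ K j i := by
  have h : ∀ i, ∃ j, ∀ l, K l i = if l = j then 1 else 0 := by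
    intro i
    obtain ⟨j, -, hj⟩ := Finset.exists_ne_zero_of_sum_ne_zero
      (show ∑ j, K j i ≠ 0 by rw [hK i]; exact one_ne_zero)
    refine ⟨j, fun l => ?_⟩
    have h1 := hK i
    rw [← Finset.add_sum_erase _ _ (Finset.mem_univ j)] at h1
    split_ifs with hl
    · subst hl
      omega
    · have h2 := Finset.single_le_sum (f := fun l => K l i) (fun _ _ => Nat.zero_le _)
        (Finset.mem_erase.2 ⟨hl, Finset.mem_univ l⟩)
      omega
  choose J hJ using h
  refine ⟨(MultilinearMap.mkPiAlgebra F (Fin n) F).compLinearMap fun i => LinearMap.proj (J i),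
    fun u => ?_⟩
  rw [Finset.prod_comm]
  simp [hJ, pow_ite]

theorem exists_multilinearMap_eq_fnDefect {F : Type*} [Field F] {p : ℕ} [CharP F p]
    (hp : p.Prime) {d : ℕ} (f : MvPolynomial (Fin d) F) (h0 : constantCoeff f = 0) (n : ℕ)
    (h1 : ∀ m ∈ f.support, ∑ j, pWeight p (m j) ≤ n)
    (h2 : ∀ m ∈ f.support, ∑ j, pWeight p (m j) = n → ∀ j, m j < p) :
    ∃ M : MultilinearMap F (fun _ : Fin n => Fin d → F) F,
      ∀ u, fnDefect (fun a => eval a f) n u = M u := by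
  have key : ∀ m ∈ f.support, ∀ K ∈ Fintype.piFinset
      fun j => (univ : Finset (Fin n)).piAntidiag (m j),
      ∃ M : MultilinearMap F (fun _ : Fin n => Fin d → F) F,
        ∀ u, M u = coeff m f * defectFactor F K * ∏ j, ∏ i, u i j ^ K j i := by
    intro m hm K hK
    by_cases hc : defectFactor F K = 0
    · exact ⟨0, fun u => by simp [hc]⟩
    obtain ⟨hw, hne⟩ := (defectFactor_ne_zero_iff hp K).1 hc
    have hsum : ∀ j, ∑ i, K j i = m j := fun j =>
      (Finset.mem_piAntidiag.1 (Fintype.mem_piFinset.1 hK j)).1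
    simp_rw [hsum] at hw
    have htot : ∑ j, pWeight p (m j) = ∑ i, ∑ j, pWeight p (K j i) := by
      rw [Finset.sum_comm]
      exact Finset.sum_congr rfl fun j _ => (hw j).symm
    have hpos : ∀ i, 1 ≤ ∑ j, pWeight p (K j i) := by
      intro i
      obtain ⟨j, -, hj⟩ := Finset.exists_ne_zero_of_sum_ne_zero (hne i)
      exact (pWeight_pos hp (Nat.pos_of_ne_zero hj)).trans_le
        (Finset.single_le_sum (f := fun j => pWeight p (K j i)) (fun _ _ => Nat.zero_le _)
          (Finset.mem_univ j))
    have hn : ∑ _i : Fin n, 1 = n := by simp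
    have hle : ∑ _i : Fin n, 1 ≤ ∑ i, ∑ j, pWeight p (K j i) :=
      Finset.sum_le_sum fun i _ => hpos i
    have heq : ∑ j, pWeight p (m j) = n := by
      have := h1 m hm
      omega
    have hone := (Finset.sum_eq_sum_iff_of_le fun i _ => hpos i).1
      (show ∑ _i : Fin n, 1 = ∑ i, ∑ j, pWeight p (K j i) by omega)
    obtain ⟨M, hM⟩ := exists_multilinearMap_prod_pow (F := F) K fun i => by
      rw [hone i (Finset.mem_univ i)]
      refine Finset.sum_congr rfl fun j _ => ((pWeight_eq_self_iff hp _).2 ?_).symm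
      refine lt_of_le_of_lt ?_ (h2 m hm heq j)
      rw [← hsum j]
      exact Finset.single_le_sum (f := K j) (fun _ _ => Nat.zero_le _) (Finset.mem_univ i)
    exact ⟨(coeff m f * defectFactor F K) • M, fun u => by
      rw [smul_apply, hM, smul_eq_mul]⟩
  choose! M hM using key
  refine ⟨∑ m ∈ f.support, ∑ K ∈ Fintype.piFinset
    fun j => (univ : Finset (Fin n)).piAntidiag (m j), M m K, fun u => ?_⟩
  rw [fnDefect_eval f h0]
  simp only [_root_.sum_apply]
  exact Finset.sum_congr rfl fun m hm => Finset.sum_congr rfl fun K hK => (hM m hm K hK u).symm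

/-- Multilinearity of the `n`-th defect bounds the `p`-degree, with equality only for totally
reduced monomials. -/
theorem pDegree_le_and_totallyReduced {F : Type*} [Field F] [Fintype F] {p : ℕ} [CharP F p]
    (hp : p.Prime) {d : ℕ} (f : MvPolynomial (Fin d) F)
    (hred : ∀ m ∈ f.support, ∀ j, m j < Fintype.card F) (h0 : constantCoeff f = 0)
    {n : ℕ} (hn : 1 ≤ n) (M : MultilinearMap F (fun _ : Fin n => Fin d → F) F)
    (hM : ∀ u, fnDefect (fun a => eval a f) n u = M u) {m : Fin d →₀ ℕ} (hm : m ∈ f.support)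
    (hle : n ≤ ∑ j, pWeight p (m j)) :
    ∑ j, pWeight p (m j) = n ∧ ∀ j, m j < p := by
  obtain ⟨n, rfl⟩ := Nat.exists_eq_succ_of_ne_zero (Nat.one_le_iff_ne_zero.1 hn)
  obtain ⟨k, hk1, hk2, hk3⟩ := exists_carryFree_decomposition hp n (fun j => m j) hle
  have hone : ∀ i, ∑ j, k i j = 1 := by
    refine sum_eq_one_of_multilinear f hred h0 M hM (fun j i => k i j) ?_
    rw [coeff_defectPoly f hm hk1]
    exact mul_ne_zero (mem_support_iff.1 hm) ((defectFactor_ne_zero_iff hp _).2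
      ⟨fun j => by rw [hk1, hk3], hk2⟩)
  have hself : ∀ i j, pWeight p (k i j) = k i j := fun i j => by
    refine (pWeight_eq_self_iff hp _).2 (lt_of_le_of_lt ?_ hp.one_lt)
    rw [← hone i]
    exact Finset.single_le_sum (f := k i) (fun _ _ => Nat.zero_le _) (Finset.mem_univ j)
  have hm_self : ∀ j, pWeight p (m j) = m j := fun j => by
    rw [← hk3, ← hk1]
    exact Finset.sum_congr rfl fun i _ => hself i j
  refine ⟨?_, fun j => (pWeight_eq_self_iff hp _).1 (hm_self j)⟩
  simp_rw [hm_self, ← hk1]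
  rw [Finset.sum_comm]
  simp [hone]

theorem fnDefect_comp_perm {F V : Type*} [Field F] [AddCommGroup V] (α : V → F) (n : ℕ)
    (w : Fin n → V) (σ : Equiv.Perm (Fin n)) : fnDefect α n (w ∘ σ) = fnDefect α n w := by
  refine Finset.sum_equiv (Equiv.finsetCongr σ) (fun S => by simp) fun S _ => ?_
  simp

/-- A reduced polynomial is homogeneous of degree `n ≥ 1` as a function iff all its degrees are
positive and congruent to `n` modulo `q - 1`. -/
theorem eval_smul_eq_pow_mul_iff {F : Type*} [Field F] [Fintype F] {d : ℕ}
    (f : MvPolynomial (Fin d) F) (hred : ∀ m ∈ f.support, ∀ j, m j < Fintype.card F)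
    (h0 : constantCoeff f = 0) {n : ℕ} (hn : 1 ≤ n) :
    (∀ (a : F) (u : Fin d → F), eval (a • u) f = a ^ n * eval u f) ↔
      ∀ m ∈ f.support, 0 < (m.sum fun _ e => e) ∧
        (m.sum fun _ e => e) ≡ n [MOD Fintype.card F - 1] := by
  have hsum : ∀ m : Fin d →₀ ℕ, (m.sum fun _ e => e) = ∑ j, m j := fun m =>
    Finsupp.sum_fintype _ _ fun _ => rfl
  have hsmul : ∀ (a : F) (u : Fin d → F), eval (a • u) f =
      ∑ m ∈ f.support, coeff m f * (a ^ (∑ j, m j) * ∏ j, u j ^ m j) := by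
    intro a u
    rw [eval_eq']
    refine Finset.sum_congr rfl fun m _ => ?_
    simp only [Pi.smul_apply, smul_eq_mul, mul_pow, Finset.prod_mul_distrib,
      Finset.prod_pow_eq_pow_sum]
  simp_rw [hsum]
  constructor
  · intro h m hm
    have hpow : ∀ a : F, a ^ (∑ j, m j) = a ^ n := by
      intro a
      have hzero := eq_zero_of_reduced_of_eval_eq_zero
        (∑ l ∈ f.support, monomial l (coeff l f * (a ^ (∑ j, l j) - a ^ n)))
        (Submodule.sum_mem _ fun l hl => monomial_mem_restrictDegree
          (fun j => Nat.le_sub_one_of_lt (hred l hl j)) _) fun v => by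
          have := h a v
          rw [hsmul, eval_eq', Finset.mul_sum, ← sub_eq_zero, ← Finset.sum_sub_distrib] at this
          rw [map_sum, ← this]
          refine Finset.sum_congr rfl fun l _ => ?_
          rw [eval_monomial, Finsupp.prod_fintype _ _ fun _ => pow_zero _]
          ring
      have hcoeff := congrArg (coeff m) hzero
      simp only [coeff_sum, coeff_monomial, coeff_zero, Finset.sum_ite_eq', if_pos hm] at hcoeff
      exact sub_eq_zero.1 ((mul_eq_zero.1 hcoeff).resolve_left (mem_support_iff.1 hm))
    constructor
    · refine Nat.pos_of_ne_zero fun hz => mem_support_iff.1 hm ?_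
      have : m = 0 := Finsupp.ext fun j => by
        simpa using Finset.sum_eq_zero_iff.1 hz j (Finset.mem_univ j)
      rw [this]
      exact h0
    · obtain ⟨g, hg⟩ := IsCyclic.exists_ofOrder_eq_natCard (α := Fˣ)
      have hpg : g ^ (∑ j, m j) = g ^ n := Units.ext (by simpa using hpow g)
      rwa [pow_eq_pow_iff_modEq, hg, Nat.card_units, Nat.card_eq_fintype_card] at hpg
  · intro h a u
    rw [hsmul, eval_eq', Finset.mul_sum]
    refine Finset.sum_congr rfl fun m hm => ?_
    have hpow : a ^ (∑ j, m j) = a ^ n := by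
      rcases eq_or_ne a 0 with rfl | ha
      · rw [zero_pow (h m hm).1.ne', zero_pow (by omega)]
      · exact pow_eq_pow_of_modEq (h m hm).2 (FiniteField.pow_card_sub_one_eq_one a ha)
    rw [hpow]
    ring

/-- let `F` be a finite field of characteristic `p` with `q` elements,
`f` a reduced polynomial with `f(0) = 0`, `α` its evaluation function, `n ≥ 1`.
Then `α` is an `n`-application (`α(a·u) = a^n·α(u)` and `Δ^n α` symmetric `n`-linear)
if and only if: every monomial of `f` has `p`-degree at most `n`; every monomial of
`p`-degree exactly `n` is totally reduced; and every monomial has positive total degree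
congruent to `n` modulo `q − 1`. -/
theorem napplication_iff_conditions
    {F : Type*} [Field F] [Fintype F] {p : ℕ} [CharP F p] (hp : p.Prime)
    {d : ℕ} (f : MvPolynomial (Fin d) F)
    (hred : ∀ m ∈ f.support, ∀ j, m j < Fintype.card F)
    (h0 : MvPolynomial.constantCoeff f = 0)
    (α : (Fin d → F) → F) (hα : ∀ a, α a = MvPolynomial.eval a f)
    (n : ℕ) (hn : 1 ≤ n) :
    ((∀ (a : F) (u : Fin d → F), α (a • u) = a ^ n * α u) ∧
     (∀ (w : Fin n → (Fin d → F)) (σ : Equiv.Perm (Fin n)),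
        fnDefect α n (w ∘ σ) = fnDefect α n w) ∧
     (∀ (w : Fin n → (Fin d → F)) (i : Fin n) (x y : Fin d → F),
        fnDefect α n (Function.update w i (x + y)) =
          fnDefect α n (Function.update w i x) + fnDefect α n (Function.update w i y)) ∧
     (∀ (w : Fin n → (Fin d → F)) (i : Fin n) (c : F) (x : Fin d → F),
        fnDefect α n (Function.update w i (c • x)) =
          c * fnDefect α n (Function.update w i x))) ↔
    ((∀ m ∈ f.support, (∑ j, pWeight p (m j)) ≤ n) ∧
     (∀ m ∈ f.support, (∑ j, pWeight p (m j)) = n → ∀ j, m j < p) ∧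
     (∀ m ∈ f.support, 0 < (m.sum fun _ e => e) ∧
        (m.sum fun _ e => e) ≡ n [MOD Fintype.card F - 1])) := by
  obtain rfl : α = fun a => eval a f := funext hα
  rw [eval_smul_eq_pow_mul_iff f hred h0 hn]
  constructor
  · rintro ⟨hhom, -, hadd, hsmul⟩
    let M : MultilinearMap F (fun _ : Fin n => Fin d → F) F :=
      MultilinearMap.mk' (fnDefect (fun a => eval a f) n) hadd hsmul
    have key := fun m (hm : m ∈ f.support) =>
      pDegree_le_and_totallyReduced hp f hred h0 hn M (fun _ => rfl) hm
    refine ⟨fun m hm => ?_, fun m hm h => (key m hm h.ge).2, hhom⟩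
    by_contra! hlt
    exact hlt.ne' (key m hm hlt.le).1
  · rintro ⟨h1, h2, hhom⟩
    obtain ⟨M, hM⟩ := exists_multilinearMap_eq_fnDefect hp f h0 n h1 h2
    refine ⟨hhom, fnDefect_comp_perm _ n, fun w i x y => ?_, fun w i c x => ?_⟩
    · simp_rw [hM, M.map_update_add]
    · simp_rw [hM, M.map_update_smul, smul_eq_mul]
end

section
/- Let F be a finite field of characteristic p with q = |F| elements, let V = F^d, and let n ≥ 1. Let T∩D denote the F-vector space of all functions α : V → F whose reduced polynomial representative f satisfies: every monomial of f has p-degree at most n, every monomial of f with p-degree equal to n is totally reduced, and every monomial of f has positive total degree congruent to n modulo q − 1. Then the polarization map α ↦ Δ^n α is an F-linear map from T∩D onto the space of characteristic symmetric n-linear forms V^n → F, and its kernel consists exactly of those α ∈ T∩D whose reduced representative has every monomial of p-degree at most n − 1 (equivalently, combinatorial degree of α at most n − 1). Consequently, the space of characteristic symmetric n-linear forms on V is isomorphic to the quotient of T∩D by this kernel. -/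
open MvPolynomial Finset Function

/-- A polynomial over a finite field is reduced if every exponent is `< |F|`. -/
def Reduced {F : Type*} [Field F] [Fintype F] {d : ℕ} (f : MvPolynomial (Fin d) F) :
    Prop :=
  ∀ m ∈ f.support, ∀ j, m j < Fintype.card F

/-- A function `φ : V^n → F` is a characteristic symmetric `n`-linear form if it is
symmetric, `F`-linear in each argument, and, whenever `p = char F` is positive and
`p ≤ n`, it vanishes as soon as its first `p` arguments are equal. -/
def IsCharSymNLinear {F V : Type*} [Field F] [AddCommGroup V] [Module F V]
    (p n : ℕ) (φ : (Fin n → V) → F) : Prop :=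
  (∀ (w : Fin n → V) (σ : Equiv.Perm (Fin n)), φ (w ∘ σ) = φ w) ∧
  (∀ (w : Fin n → V) (i : Fin n) (x y : V),
    φ (Function.update w i (x + y)) =
      φ (Function.update w i x) + φ (Function.update w i y)) ∧
  (∀ (w : Fin n → V) (i : Fin n) (c : F) (x : V),
    φ (Function.update w i (c • x)) = c * φ (Function.update w i x)) ∧
  (p ≠ 0 → p ≤ n → ∀ (u : V) (w : Fin n → V),
    (∀ i : Fin n, (i : ℕ) < p → w i = u) → φ w = 0)

/-- Membership in `T∩D`: the reduced polynomial representative of `α` has all monomials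
of `p`-degree at most `n`, all monomials of `p`-degree exactly `n` totally reduced, and
all monomials of positive total degree congruent to `n` modulo `q − 1`. -/
def InTD {F : Type*} [Field F] [Fintype F] (p : ℕ) {d : ℕ} (n : ℕ)
    (α : (Fin d → F) → F) : Prop :=
  ∃ f : MvPolynomial (Fin d) F, Reduced f ∧ (∀ a, MvPolynomial.eval a f = α a) ∧
    (∀ m ∈ f.support, (∑ j, pWeight p (m j)) ≤ n) ∧
    (∀ m ∈ f.support, (∑ j, pWeight p (m j)) = n → ∀ j, m j < p) ∧
    (∀ m ∈ f.support, 0 < (m.sum fun _ e => e) ∧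
      (m.sum fun _ e => e) ≡ n [MOD Fintype.card F - 1])

section Defect

variable {F V : Type*} [Field F] [AddCommGroup V]

/-- The `n`-th defect as an `F`-linear map. -/
def fnDefectLinear (F V : Type*) [Field F] [AddCommGroup V] (n : ℕ) :
    (V → F) →ₗ[F] ((Fin n → V) → F) where
  toFun α := fnDefect α n
  map_add' α β := by
    funext u
    simp [fnDefect, mul_add, Finset.sum_add_distrib]
  map_smul' c α := by
    funext u
    simp [fnDefect, Finset.mul_sum, mul_left_comm]

lemma fnDefectLinear_apply (n : ℕ) (α : V → F) : fnDefectLinear F V n α = fnDefect α n := rfl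

lemma sum_superset_neg_one_pow {n : ℕ} (T : Finset (Fin n)) :
    ∑ S : Finset (Fin n), (if T ⊆ S then (-1 : F) ^ (n - S.card) else 0) =
      if T = Finset.univ then 1 else 0 := by
  have key := congrArg (Int.cast : ℤ → F)
    (Finset.sum_powerset_neg_one_pow_card (x := Tᶜ))
  push_cast at key
  simp only [Finset.compl_eq_empty_iff] at key
  rw [← key, ← Finset.sum_filter]
  refine Finset.sum_bij' (fun S _ => Sᶜ) (fun S _ => Sᶜ) ?_ ?_ ?_ ?_ ?_
  · intro S hS
    simpa using hS
  · intro S hS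
    simpa [Finset.subset_compl_comm] using hS
  · simp
  · simp
  · intro S _
    simp [Finset.card_compl]

/-- The defect of a nonempty product of additive functions is a sum over surjections. -/
lemma fnDefect_prod {κ : Type*} [Fintype κ] [DecidableEq κ] [Nonempty κ] {n : ℕ}
    (ℓ : κ → V →+ F) (u : Fin n → V) :
    fnDefect (fun v => ∏ k, ℓ k v) n u =
      ∑ f : κ → Fin n with Surjective f, ∏ k, ℓ k (u (f k)) := by
  have expand (S : Finset (Fin n)) : ∏ k, ℓ k (∑ i ∈ S, u i) =
      ∑ f : κ → Fin n, if Finset.univ.image f ⊆ S then ∏ k, ℓ k (u (f k)) else 0 := by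
    simp only [map_sum]
    rw [Finset.prod_univ_sum, ← Finset.sum_filter]
    refine Finset.sum_congr ?_ fun _ _ => rfl
    ext f
    simp [Fintype.mem_piFinset, Finset.image_subset_iff]
  have full : fnDefect (fun v => ∏ k, ℓ k v) n u =
      ∑ S : Finset (Fin n), (-1 : F) ^ (n - S.card) * ∏ k, ℓ k (∑ i ∈ S, u i) := by
    rw [fnDefect, Finset.powerset_univ, Finset.sum_filter]
    refine Finset.sum_congr rfl fun S _ => ?_
    split_ifs with hS
    · rfl
    · rw [Finset.not_nonempty_iff_eq_empty] at hS
      simp [hS]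
  rw [full, Finset.sum_filter]
  simp only [expand, Finset.mul_sum]
  rw [Finset.sum_comm]
  refine Finset.sum_congr rfl fun f _ => ?_
  have := sum_superset_neg_one_pow (F := F) (Finset.univ.image f)
  have hsurj : Finset.univ.image f = Finset.univ ↔ Surjective f := by
    simp [Finset.eq_univ_iff_forall, Surjective]
  simp only [hsurj] at this
  rw [← one_mul (∏ k, ℓ k (u (f k))), ← zero_mul (∏ k, ℓ k (u (f k))), ← ite_mul, ← this,
    Finset.sum_mul]
  refine Finset.sum_congr rfl fun S _ => ?_
  split_ifs <;> simp

/-- `g` is a product of `N` additive functions. -/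
def IsAdditiveProduct (N : ℕ) (g : V → F) : Prop :=
  ∃ l : List (V →+ F), l.length = N ∧ ∀ v, g v = (l.map fun ℓ => ℓ v).prod

lemma IsAdditiveProduct.one : IsAdditiveProduct 0 (1 : V → F) := ⟨[], rfl, by simp⟩

lemma IsAdditiveProduct.mul {N M : ℕ} {g h : V → F} (hg : IsAdditiveProduct N g)
    (hh : IsAdditiveProduct M h) : IsAdditiveProduct (N + M) (g * h) := by
  obtain ⟨l, rfl, hl⟩ := hg
  obtain ⟨l', rfl, hl'⟩ := hh
  exact ⟨l ++ l', by simp, fun v => by simp [hl, hl']⟩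

lemma IsAdditiveProduct.finset_prod {ι : Type*} (s : Finset ι) (N : ι → ℕ) (g : ι → V → F)
    (h : ∀ i ∈ s, IsAdditiveProduct (N i) (g i)) :
    IsAdditiveProduct (∑ i ∈ s, N i) (∏ i ∈ s, g i) := by
  classical
  induction s using Finset.induction_on with
  | empty => simpa using .one
  | insert a s ha ih =>
    rw [Finset.sum_insert ha, Finset.prod_insert ha]
    exact (h a (by simp)).mul (ih fun i hi => h i (by simp [hi]))

lemma isAdditiveProduct_pow (ℓ : V →+ F) (r : ℕ) :
    IsAdditiveProduct r (fun v => ℓ v ^ r) :=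
  ⟨List.replicate r ℓ, by simp, by simp⟩

lemma isAdditiveProduct_pow_pWeight {p : ℕ} [CharP F p] (hp : p.Prime) (t : ℕ) :
    ∀ ℓ : V →+ F, IsAdditiveProduct (pWeight p t) (fun v => ℓ v ^ t) := by
  induction t using Nat.strong_induction_on with
  | _ t ih =>
    intro ℓ
    rcases Nat.eq_zero_or_pos t with rfl | ht
    · simpa [pWeight] using! IsAdditiveProduct.one
    have : Fact p.Prime := ⟨hp⟩
    have hw : pWeight p t = t % p + pWeight p (t / p) := by
      simp [pWeight, hp.ne_zero, Nat.digits_def' hp.one_lt ht]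
    rw [hw]
    have hfun : (fun v => ℓ v ^ t) =
        (fun v => ℓ v ^ (t % p)) *
          fun v => ((frobenius F p).toAddMonoidHom.comp ℓ) v ^ (t / p) := by
      funext v
      simp [frobenius_def, ← pow_mul, ← pow_add, Nat.mod_add_div]
    rw [hfun]
    exact (isAdditiveProduct_pow ℓ _).mul (ih _ (Nat.div_lt_self ht hp.one_lt) _)

lemma IsAdditiveProduct.fnDefect_eq_zero {N n : ℕ} {g : V → F} (hg : IsAdditiveProduct N g)
    (hg0 : g 0 = 0) (hN : N < n) : fnDefect g n = 0 := by
  obtain ⟨l, rfl, hl⟩ := hg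
  have hprod : g = fun v => ∏ k : Fin l.length, l.get k v := by
    funext v
    rw [hl, ← Fin.prod_univ_getElem, ← Fin.prod_congr' _ (List.length_map ..).symm]
    simp
  have : Nonempty (Fin l.length) := by
    by_contra hne
    rw [not_nonempty_iff] at hne
    simp [hprod] at hg0
  funext u
  rw [hprod, fnDefect_prod, Finset.filter_false_of_mem, Finset.sum_empty, Pi.zero_apply]
  intro f _ hf
  have := Fintype.card_le_of_surjective f hf
  simp only [Fintype.card_fin] at this
  omega

end Defect

section Permanent

/-- The number of preimages of each point under `c : Fin n → β`. -/
def fiberCard {β : Type*} [DecidableEq β] {n : ℕ} (c : Fin n → β) (b : β) : ℕ :=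
  (Finset.univ.filter fun k => c k = b).card

lemma exists_perm_comp_eq {β : Type*} [DecidableEq β] {n : ℕ} {c c' : Fin n → β}
    (h : fiberCard c = fiberCard c') : ∃ σ : Equiv.Perm (Fin n), c ∘ σ = c' := by
  have e (b : β) : Nonempty ({k // c' k = b} ≃ {k // c k = b}) := by
    rw [← Fintype.card_eq, Fintype.card_subtype, Fintype.card_subtype]
    exact (congrFun h b).symm
  exact ⟨Equiv.ofFiberEquiv fun b => (e b).some, funext fun k => Equiv.ofFiberEquiv_map _ k⟩

lemma fiberCard_comp_perm {β : Type*} [DecidableEq β] {n : ℕ} (c : Fin n → β)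
    (σ : Equiv.Perm (Fin n)) : fiberCard (c ∘ σ) = fiberCard c := by
  funext b
  exact Finset.card_equiv σ (by simp)

lemma card_perm_comp_eq {β : Type*} [DecidableEq β] [Fintype β] {n : ℕ} (c c' : Fin n → β) :
    (Finset.univ.filter fun σ : Equiv.Perm (Fin n) => c ∘ σ = c').card =
      if fiberCard c = fiberCard c' then ∏ b, (fiberCard c b).factorial else 0 := by
  split_ifs with h
  · obtain ⟨τ, rfl⟩ := exists_perm_comp_eq h
    have hcard := DomMulAct.stabilizer_card c
    rw [Fintype.card_subtype] at hcard
    simp only [Fintype.card_subtype] at hcard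
    refine Eq.trans ?_ hcard
    refine Finset.card_equiv (Equiv.mulRight τ⁻¹) fun σ => ?_
    simp only [Finset.mem_filter, Finset.mem_univ, true_and, Equiv.coe_mulRight,
      Equiv.Perm.coe_mul, ← Function.comp_assoc]
    constructor
    · intro hσ
      rw [hσ, Function.comp_assoc, ← Equiv.Perm.coe_mul, mul_inv_cancel]
      rfl
    · intro hσ
      conv_rhs => rw [← hσ]
      rw [Function.comp_assoc, ← Equiv.Perm.coe_mul, inv_mul_cancel]
      rfl
  · rw [Finset.card_eq_zero, Finset.filter_eq_empty_iff]
    rintro σ - rfl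
    exact h (fiberCard_comp_perm c σ).symm

variable {F : Type*} [Field F] {d n : ℕ}

/-- The full polarization of the monomial `∏ k, x (c k)`. -/
def permForm (F : Type*) [Field F] (c : Fin n → Fin d) :
    MultilinearMap F (fun _ : Fin n => Fin d → F) F :=
  ∑ σ : Equiv.Perm (Fin n), (MultilinearMap.mkPiAlgebra F (Fin n) F).compLinearMap
    fun i => LinearMap.proj (c (σ i))

lemma permForm_apply (c : Fin n → Fin d) (u : Fin n → Fin d → F) :
    permForm F c u = ∑ σ : Equiv.Perm (Fin n), ∏ k, u (σ k) (c k) := by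
  simp only [permForm, _root_.sum_apply, MultilinearMap.compLinearMap_apply,
    MultilinearMap.mkPiAlgebra_apply, LinearMap.proj_apply]
  refine Fintype.sum_equiv (Equiv.inv _) _ _ fun σ => ?_
  refine Fintype.prod_equiv σ _ _ fun k => ?_
  simp

lemma permForm_single (c c' : Fin n → Fin d) :
    permForm F c (fun i => Pi.single (c' i) 1) =
      if fiberCard c' = fiberCard c then ((∏ b, (fiberCard c b).factorial : ℕ) : F) else 0 := by
  have hterm (σ : Equiv.Perm (Fin n)) :
      ∏ k, (Pi.single (c' (σ k)) (1 : F) : Fin d → F) (c k) =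
        if c' ∘ σ = c then 1 else 0 := by
    simp only [Pi.single_apply, Finset.prod_ite_zero, Finset.prod_const_one, funext_iff,
      Function.comp_apply, Finset.mem_univ, true_implies, eq_comm]
  rw [permForm_apply]
  simp only [hterm]
  rw [Finset.sum_boole, card_perm_comp_eq]
  split_ifs with h
  · rw [h]
  · simp

lemma isCharSymNLinear_permForm [Fintype F] {p : ℕ} [CharP F p] (hp : p.Prime)
    (c : Fin n → Fin d) : IsCharSymNLinear p n (permForm F c) := by
  classical
  refine ⟨fun w τ => ?_, fun w i x y => ?_, fun w i a x => ?_, fun _ hpn u w hw => ?_⟩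
  · rw [permForm_apply, permForm_apply]
    exact Fintype.sum_equiv (Equiv.mulLeft τ) _ _ fun σ => rfl
  · exact MultilinearMap.map_update_add _ _ _ _ _
  · exact MultilinearMap.map_update_smul _ _ _ _ _
  · rw [permForm_apply]
    refine (Finset.sum_comp (s := Finset.univ) (fun v : Fin n → Fin d → F => ∏ k, v k (c k))
      (fun σ : Equiv.Perm (Fin n) => w ∘ σ)).trans ?_
    refine Finset.sum_eq_zero fun v _ => ?_
    rw [card_perm_comp_eq]
    split_ifs
    · have hfib : p ≤ fiberCard w u := by
        calc p = (Finset.univ.filter fun i : Fin n => (i : ℕ) < p).card := by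
              rw [Fin.card_filter_val_lt, min_eq_right hpn]
          _ ≤ _ := Finset.card_le_card fun i => by simpa using hw i
      have hdvd : p ∣ ∏ b, (fiberCard w b).factorial :=
        (hp.dvd_factorial.mpr hfib).trans (Finset.dvd_prod_of_mem _ (Finset.mem_univ u))
      rw [nsmul_eq_mul, (CharP.cast_eq_zero_iff F p _).mpr hdvd, zero_mul]
    · simp

lemma fnDefect_prod_coord [NeZero n] (c : Fin n → Fin d) :
    fnDefect (fun v : Fin d → F => ∏ k, v (c k)) n = permForm F c := by
  funext u
  rw [permForm_apply]
  refine (fnDefect_prod (fun k => Pi.evalAddMonoidHom (fun _ => F) (c k)) u).trans ?_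
  symm
  refine Finset.sum_bij (fun σ _ => σ) (fun σ _ => ?_) (fun _ _ _ _ h => ?_)
    (fun f hf => ?_) (fun _ _ => rfl)
  · simpa using σ.surjective
  · exact Equiv.coe_fn_injective h
  · have hf : Surjective f := by simpa using hf
    exact ⟨Equiv.ofBijective f ⟨Finite.injective_iff_surjective.mpr hf, hf⟩,
      Finset.mem_univ _, rfl⟩

end Permanent

section Monomials

variable {F : Type*} [Field F] {d : ℕ}

/-- The function on `F^d` given by the monomial with exponent `m`. -/
def monomialFn (F : Type*) [Field F] (m : Fin d →₀ ℕ) (v : Fin d → F) : F := ∏ j, v j ^ m j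

lemma exists_fiberCard_eq {n : ℕ} (m : Fin d → ℕ) (hm : ∑ j, m j = n) :
    ∃ c : Fin n → Fin d, fiberCard c = m := by
  have e : Fin n ≃ Σ j, Fin (m j) := Fintype.equivOfCardEq (by simp [hm])
  refine ⟨fun k => (e k).1, funext fun j => ?_⟩
  rw [fiberCard, ← Fintype.card_subtype]
  rw [Fintype.card_congr (e.subtypeEquiv (q := fun x => x.1 = j) fun _ => Iff.rfl),
    Fintype.card_congr (Equiv.sigmaSubtype j), Fintype.card_fin]

lemma sum_fiberCard {n : ℕ} (c : Fin n → Fin d) : ∑ j, fiberCard c j = n := by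
  simpa [fiberCard] using
    (Finset.card_eq_sum_card_fiberwise (f := c) (s := Finset.univ) (t := Finset.univ)
      (by simp)).symm

lemma monomialFn_of_fiberCard {n : ℕ} {c : Fin n → Fin d} {m : Fin d →₀ ℕ}
    (h : fiberCard c = m) : monomialFn F m = fun v => ∏ k, v (c k) := by
  funext v
  rw [monomialFn, ← h, ← Finset.prod_fiberwise _ c]
  refine Finset.prod_congr rfl fun j _ => ?_
  rw [Finset.prod_congr rfl (g := fun _ => v j) (by simp +contextual), Finset.prod_const,
    fiberCard]

lemma fnDefect_monomialFn_eq_zero {p : ℕ} [CharP F p] (hp : p.Prime) {n : ℕ}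
    {m : Fin d →₀ ℕ} (hm0 : m ≠ 0) (hm : ∑ j, pWeight p (m j) < n) :
    fnDefect (monomialFn F m) n = 0 := by
  have hprod := IsAdditiveProduct.finset_prod (F := F) (V := Fin d → F) Finset.univ
    (fun j => pWeight p (m j)) (fun j v => v j ^ m j) fun j _ =>
      isAdditiveProduct_pow_pWeight hp (m j) (Pi.evalAddMonoidHom (fun _ => F) j)
  have heq : ∏ j, (fun v : Fin d → F => v j ^ m j) = monomialFn F m := by
    funext v
    simp [monomialFn]
  rw [heq] at hprod
  refine hprod.fnDefect_eq_zero ?_ hm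
  obtain ⟨j, hj⟩ := Finsupp.ne_iff.mp hm0
  exact Finset.prod_eq_zero (Finset.mem_univ j) (zero_pow hj)

lemma pWeight_of_lt {p t : ℕ} (h : t < p) : pWeight p t = t := by
  rcases Nat.eq_zero_or_pos t with rfl | ht
  · simp [pWeight]
  · simp [pWeight, Nat.digits_of_lt p t ht.ne' h, (ht.trans h).ne']

lemma prod_factorial_eq_zero {p : ℕ} [CharP F p] (hp : p.Prime) {m : Fin d → ℕ} {j : Fin d}
    (hj : p ≤ m j) : ((∏ j, (m j).factorial : ℕ) : F) = 0 :=
  (CharP.cast_eq_zero_iff F p _).mpr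
    ((hp.dvd_factorial.mpr hj).trans (Finset.dvd_prod_of_mem _ (Finset.mem_univ j)))

lemma prod_factorial_ne_zero {p : ℕ} [CharP F p] (hp : p.Prime) {m : Fin d → ℕ}
    (hm : ∀ j, m j < p) : ((∏ j, (m j).factorial : ℕ) : F) ≠ 0 := by
  rw [Ne, CharP.cast_eq_zero_iff F p, hp.prime.dvd_finsetProd_iff]
  rintro ⟨j, -, hj⟩
  exact (hm j).not_ge (hp.dvd_factorial.mp hj)

end Monomials

section Admissible

variable {F : Type*} [Field F] {p d n : ℕ}

/-- Nonconstant monomials of `p`-degree at most `n`, totally reduced if of `p`-degree `n`. -/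
def AdmissibleExponent (p n : ℕ) (m : Fin d →₀ ℕ) : Prop :=
  m ≠ 0 ∧ ∑ j, pWeight p (m j) ≤ n ∧ (∑ j, pWeight p (m j) = n → ∀ j, m j < p)

lemma AdmissibleExponent.fnDefect_eq [CharP F p] (hp : p.Prime) [NeZero n] {m : Fin d →₀ ℕ}
    (hm : AdmissibleExponent p n m) :
    (∑ j, pWeight p (m j) < n ∧ fnDefect (monomialFn F m) n = 0) ∨
      ∃ c : Fin n → Fin d, fiberCard c = m ∧ fnDefect (monomialFn F m) n = permForm F c := by
  obtain ⟨hm0, hle, htop⟩ := hm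
  rcases hle.lt_or_eq with hlt | heq
  · exact .inl ⟨hlt, fnDefect_monomialFn_eq_zero hp hm0 hlt⟩
  · have hdeg : ∑ j, m j = n := by
      rw [← heq]
      exact Finset.sum_congr rfl fun j _ => (pWeight_of_lt (htop heq j)).symm
    obtain ⟨c, hc⟩ := exists_fiberCard_eq m hdeg
    exact .inr ⟨c, hc, by rw [monomialFn_of_fiberCard hc, fnDefect_prod_coord]⟩

lemma AdmissibleExponent.fnDefect_single [CharP F p] (hp : p.Prime) [NeZero n]
    {m : Fin d →₀ ℕ} (hm : AdmissibleExponent p n m) (c : Fin n → Fin d) :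
    fnDefect (monomialFn F m) n (fun i => Pi.single (c i) 1) =
      if fiberCard c = m then ((∏ j, (fiberCard c j).factorial : ℕ) : F) else 0 := by
  rcases hm.fnDefect_eq (F := F) hp with ⟨hlt, h0⟩ | ⟨c', hc', hperm⟩
  · rw [h0, Pi.zero_apply]
    split_ifs with h
    · obtain ⟨j, hj⟩ : ∃ j, p ≤ fiberCard c j := by
        by_contra! hall
        refine hlt.ne ?_
        rw [← h, Finset.sum_congr rfl fun j _ => pWeight_of_lt (hall j), sum_fiberCard]
      exact (prod_factorial_eq_zero hp hj).symm
    · rfl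
  · rw [hperm, permForm_single, hc']
    split_ifs with h
    · rw [h]
    · rfl

lemma IsCharSymNLinear.zero {V : Type*} [AddCommGroup V] [Module F V] :
    IsCharSymNLinear p n (0 : (Fin n → V) → F) := by
  simp [IsCharSymNLinear]

lemma IsCharSymNLinear.add {V : Type*} [AddCommGroup V] [Module F V]
    {φ ψ : (Fin n → V) → F} (hφ : IsCharSymNLinear p n φ) (hψ : IsCharSymNLinear p n ψ) :
    IsCharSymNLinear p n (φ + ψ) := by
  refine ⟨fun w σ => ?_, fun w i x y => ?_, fun w i c x => ?_, fun h0 hpn u w hw => ?_⟩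
  · simp only [Pi.add_apply, hφ.1, hψ.1]
  · simp only [Pi.add_apply, hφ.2.1, hψ.2.1]
    ring
  · simp only [Pi.add_apply, hφ.2.2.1, hψ.2.2.1]
    ring
  · simp only [Pi.add_apply, hφ.2.2.2 h0 hpn u w hw, hψ.2.2.2 h0 hpn u w hw, add_zero]

lemma IsCharSymNLinear.smul {V : Type*} [AddCommGroup V] [Module F V]
    {φ : (Fin n → V) → F} (hφ : IsCharSymNLinear p n φ) (a : F) :
    IsCharSymNLinear p n (a • φ) := by
  refine ⟨fun w σ => ?_, fun w i x y => ?_, fun w i c x => ?_, fun h0 hpn u w hw => ?_⟩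
  · simp only [Pi.smul_apply, hφ.1]
  · simp only [Pi.smul_apply, hφ.2.1, smul_add]
  · simp only [Pi.smul_apply, hφ.2.2.1, smul_eq_mul]
    ring
  · simp only [Pi.smul_apply, hφ.2.2.2 h0 hpn u w hw, smul_zero]

lemma IsCharSymNLinear.sum {V ι : Type*} [AddCommGroup V] [Module F V] (s : Finset ι)
    (φ : ι → (Fin n → V) → F) (h : ∀ i ∈ s, IsCharSymNLinear p n (φ i)) :
    IsCharSymNLinear p n (∑ i ∈ s, φ i) :=
  Finset.sum_induction _ _ (fun _ _ => .add) .zero h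

lemma IsCharSymNLinear.eq_of_single {φ ψ : (Fin n → Fin d → F) → F}
    (hφ : IsCharSymNLinear p n φ) (hψ : IsCharSymNLinear p n ψ)
    (h : ∀ c : Fin n → Fin d, φ (fun i => Pi.single (c i) 1) = ψ fun i => Pi.single (c i) 1) :
    φ = ψ := by
  let toMultilinear (χ : (Fin n → Fin d → F) → F) (hχ : IsCharSymNLinear p n χ) :
      MultilinearMap F (fun _ : Fin n => Fin d → F) F :=
    { toFun := χ
      map_update_add' := fun {inst} w i x y => by
        rw [Subsingleton.elim inst (instDecidableEqFin n)]
        exact hχ.2.1 w i x y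
      map_update_smul' := fun {inst} w i c x => by
        rw [Subsingleton.elim inst (instDecidableEqFin n)]
        exact hχ.2.2.1 w i c x }
  have key : toMultilinear φ hφ = toMultilinear ψ hψ :=
    Module.Basis.ext_multilinear (fun _ => Pi.basisFun F (Fin d)) fun c => by
      simpa [toMultilinear] using h c
  exact congrArg (fun χ : MultilinearMap F (fun _ : Fin n => Fin d → F) F => ⇑χ) key

lemma IsCharSymNLinear.single_eq_of_fiberCard_eq {φ : (Fin n → Fin d → F) → F}
    (hφ : IsCharSymNLinear p n φ) {c c' : Fin n → Fin d} (h : fiberCard c = fiberCard c') :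
    φ (fun i => Pi.single (c i) 1) = φ fun i => Pi.single (c' i) 1 := by
  obtain ⟨σ, rfl⟩ := exists_perm_comp_eq h
  exact (hφ.1 _ σ).symm

lemma IsCharSymNLinear.single_eq_zero (hp : p.Prime) {φ : (Fin n → Fin d → F) → F}
    (hφ : IsCharSymNLinear p n φ) {c : Fin n → Fin d} {j : Fin d} (hj : p ≤ fiberCard c j) :
    φ (fun i => Pi.single (c i) 1) = 0 := by
  have hpn : p ≤ n := hj.trans <|
    (Finset.single_le_sum (fun _ _ => Nat.zero_le _) (Finset.mem_univ j)).trans_eq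
      (sum_fiberCard c)
  obtain ⟨T, hT, hTcard⟩ := Finset.exists_subset_card_eq hj
  have e : {i : Fin n // (i : ℕ) < p} ≃ {i // i ∈ T} := Fintype.equivOfCardEq <| by
    rw [Fintype.card_subtype, Fin.card_filter_val_lt, min_eq_right hpn, Fintype.card_coe, hTcard]
  rw [← hφ.1 _ e.extendSubtype]
  refine hφ.2.2.2 hp.ne_zero hpn (Pi.single j 1) _ fun i hi => ?_
  have hmem := hT (e.extendSubtype_mem i hi)
  rw [Finset.mem_filter] at hmem
  simp [hmem.2]

lemma eval_eq_sum_monomialFn {f : MvPolynomial (Fin d) F} {α : (Fin d → F) → F}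
    (hf : ∀ a, eval a f = α a) : α = ∑ m ∈ f.support, coeff m f • monomialFn F m := by
  funext a
  simp [← hf, eval_eq', monomialFn]

lemma fnDefect_eq_sum (n : ℕ) {f : MvPolynomial (Fin d) F} {α : (Fin d → F) → F}
    (hf : ∀ a, eval a f = α a) :
    fnDefect α n = ∑ m ∈ f.support, coeff m f • fnDefect (monomialFn F m) n := by
  rw [← fnDefectLinear_apply, eval_eq_sum_monomialFn hf, map_sum]
  simp only [map_smul, fnDefectLinear_apply]

variable [CharP F p] [NeZero n] {f : MvPolynomial (Fin d) F} {α : (Fin d → F) → F}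

lemma isCharSymNLinear_fnDefect [Fintype F] (hp : p.Prime) (hf : ∀ a, eval a f = α a)
    (hadm : ∀ m ∈ f.support, AdmissibleExponent p n m) :
    IsCharSymNLinear p n (fnDefect α n) := by
  rw [fnDefect_eq_sum n hf]
  refine .sum _ _ fun m hm => .smul ?_ _
  rcases (hadm m hm).fnDefect_eq (F := F) hp with ⟨-, h0⟩ | ⟨c, -, hc⟩
  · rw [h0]
    exact .zero
  · rw [hc]
    exact isCharSymNLinear_permForm hp c

lemma fnDefect_single (hp : p.Prime) (hf : ∀ a, eval a f = α a)
    (hadm : ∀ m ∈ f.support, AdmissibleExponent p n m) (c : Fin n → Fin d) :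
    fnDefect α n (fun i => Pi.single (c i) 1) =
      coeff (Finsupp.equivFunOnFinite.symm (fiberCard c)) f *
        ((∏ j, (fiberCard c j).factorial : ℕ) : F) := by
  have hiff (m : Fin d →₀ ℕ) :
      fiberCard c = m ↔ Finsupp.equivFunOnFinite.symm (fiberCard c) = m := by
    rw [Equiv.symm_apply_eq]
    rfl
  rw [fnDefect_eq_sum n hf, Finset.sum_apply]
  simp only [Pi.smul_apply, smul_eq_mul]
  rw [Finset.sum_congr rfl fun m hm => by rw [(hadm m hm).fnDefect_single hp c]]
  simp only [hiff, mul_ite, mul_zero, Finset.sum_ite_eq]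
  split_ifs with h
  · rfl
  · rw [notMem_support_iff.mp h, zero_mul]

lemma fnDefect_eq_zero_iff (hp : p.Prime) (hf : ∀ a, eval a f = α a)
    (hadm : ∀ m ∈ f.support, AdmissibleExponent p n m) :
    fnDefect α n = 0 ↔ ∀ m ∈ f.support, ∑ j, pWeight p (m j) < n := by
  constructor
  · intro h0 m hm
    by_contra hlt
    obtain ⟨-, hle, htop⟩ := hadm m hm
    have heq := hle.antisymm (not_lt.mp hlt)
    have hdeg : ∑ j, m j = n := by
      rw [← heq]
      exact Finset.sum_congr rfl fun j _ => (pWeight_of_lt (htop heq j)).symm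
    obtain ⟨c, hc⟩ := exists_fiberCard_eq m hdeg
    have hm' : Finsupp.equivFunOnFinite.symm (fiberCard c) = m := by
      rw [hc]
      exact Finsupp.equivFunOnFinite.symm_apply_apply m
    have hval := fnDefect_single hp hf hadm c
    rw [h0, hm', hc, Pi.zero_apply, eq_comm, mul_eq_zero] at hval
    exact hval.elim (mem_support_iff.mp hm) (prod_factorial_ne_zero hp (htop heq))
  · intro h
    rw [fnDefect_eq_sum n hf]
    exact Finset.sum_eq_zero fun m hm => by
      rw [fnDefect_monomialFn_eq_zero hp (hadm m hm).1 (h m hm), smul_zero]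

end Admissible

section FiniteField

variable {F : Type*} [Field F] [Fintype F] {p d n : ℕ}

lemma Reduced.eq_of_eval_eq {f g : MvPolynomial (Fin d) F} (hf : Reduced f) (hg : Reduced g)
    (h : ∀ a, eval a f = eval a g) : f = g := by
  rw [← sub_eq_zero]
  refine eq_zero_of_eval_zero_at_prod_finset _ (fun _ => Finset.univ) (fun i => ?_) fun x _ => ?_
  · rw [degreeOf_eq_sup, Finset.card_univ, Finset.sup_lt_iff Fintype.card_pos]
    intro m hm
    rcases Finset.mem_union.mp (support_sub (Fin d) f g hm) with hm | hm
    · exact hf m hm i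
    · exact hg m hm i
  · rw [map_sub, h, sub_self]

lemma InTD.sub {α β : (Fin d → F) → F} (hα : InTD p n α) (hβ : InTD p n β) :
    InTD p n (α - β) := by
  obtain ⟨f, hf, hfα, hf1, hf2, hf3⟩ := hα
  obtain ⟨g, hg, hgβ, hg1, hg2, hg3⟩ := hβ
  have hmem {m : Fin d →₀ ℕ} (hm : m ∈ (f - g).support) : m ∈ f.support ∨ m ∈ g.support :=
    Finset.mem_union.mp (support_sub (Fin d) f g hm)
  refine ⟨f - g, fun m hm => ?_, fun a => by simp [hfα, hgβ], fun m hm => ?_, fun m hm => ?_,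
    fun m hm => ?_⟩
  · exact (hmem hm).elim (hf m) (hg m)
  · exact (hmem hm).elim (hf1 m) (hg1 m)
  · exact (hmem hm).elim (hf2 m) (hg2 m)
  · exact (hmem hm).elim (hf3 m) (hg3 m)

lemma InTD.exists_admissible {α : (Fin d → F) → F} (hα : InTD p n α) :
    ∃ f : MvPolynomial (Fin d) F, Reduced f ∧ (∀ a, eval a f = α a) ∧
      ∀ m ∈ f.support, AdmissibleExponent p n m := by
  obtain ⟨f, hf, hfα, h1, h2, h3⟩ := hα
  refine ⟨f, hf, hfα, fun m hm => ⟨?_, h1 m hm, h2 m hm⟩⟩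
  rintro rfl
  simpa using (h3 0 hm).1

variable [CharP F p]

lemma le_card_of_charP : p ≤ Fintype.card F :=
  Nat.le_of_dvd Fintype.card_pos
    ((CharP.cast_eq_zero_iff F p _).mp (Nat.cast_card_eq_zero F))

lemma InTD.fnDefect_eq_zero_iff [NeZero n] (hp : p.Prime) {α : (Fin d → F) → F}
    (hα : InTD p n α) :
    fnDefect α n = 0 ↔
      ∀ f : MvPolynomial (Fin d) F, Reduced f → (∀ a, eval a f = α a) →
        ∀ m ∈ f.support, ∑ j, pWeight p (m j) ≤ n - 1 := by
  obtain ⟨f, hf, hfα, hadm⟩ := hα.exists_admissible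
  rw [_root_.fnDefect_eq_zero_iff hp hfα hadm]
  have hn : 0 < n := NeZero.pos n
  constructor
  · intro h g hg hgα m hm
    obtain rfl := hg.eq_of_eval_eq hf fun a => (hgα a).trans (hfα a).symm
    exact Nat.le_sub_one_of_lt (h m hm)
  · intro h m hm
    exact Nat.lt_of_le_sub_one hn (h f hf hfα m hm)

lemma InTD.isCharSymNLinear_fnDefect [NeZero n] (hp : p.Prime) {α : (Fin d → F) → F}
    (hα : InTD p n α) : IsCharSymNLinear p n (fnDefect α n) := by
  obtain ⟨f, -, hfα, hadm⟩ := hα.exists_admissible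
  exact _root_.isCharSymNLinear_fnDefect hp hfα hadm

lemma IsCharSymNLinear.exists_fnDefect_eq [NeZero n] (hp : p.Prime)
    {φ : (Fin n → Fin d → F) → F} (hφ : IsCharSymNLinear p n φ) :
    ∃ α : (Fin d → F) → F, InTD p n α ∧ fnDefect α n = φ := by
  classical
  let expo (c : Fin n → Fin d) : Fin d →₀ ℕ := Finsupp.equivFunOnFinite.symm (fiberCard c)
  let value (m : Fin d →₀ ℕ) : F :=
    if h : ∃ c : Fin n → Fin d, expo c = m then φ fun i => Pi.single (h.choose i) 1 else 0
  have hvalue (c : Fin n → Fin d) : value (expo c) = φ fun i => Pi.single (c i) 1 := by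
    have h : ∃ c' : Fin n → Fin d, expo c' = expo c := ⟨c, rfl⟩
    simp only [value, dif_pos h]
    exact hφ.single_eq_of_fiberCard_eq (Finsupp.equivFunOnFinite.symm.injective h.choose_spec)
  let s : Finset (Fin d →₀ ℕ) := (Finset.univ.image expo).filter fun m => ∀ j, m j < p
  let f : MvPolynomial (Fin d) F :=
    ∑ m ∈ s, monomial m (value m * ((∏ j, (m j).factorial : ℕ) : F)⁻¹)
  have hcoeff (m : Fin d →₀ ℕ) :
      coeff m f = if m ∈ s then value m * ((∏ j, (m j).factorial : ℕ) : F)⁻¹ else 0 := by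
    simp only [f, coeff_sum, coeff_monomial, Finset.sum_ite_eq']
  have hsupp (m : Fin d →₀ ℕ) (hm : m ∈ f.support) : (∀ j, m j < p) ∧ ∑ j, m j = n := by
    rw [mem_support_iff, hcoeff] at hm
    have hms : m ∈ s := by
      by_contra h
      exact hm (if_neg h)
    obtain ⟨hm1, hm2⟩ := Finset.mem_filter.mp hms
    obtain ⟨c, -, rfl⟩ := Finset.mem_image.mp hm1
    exact ⟨hm2, sum_fiberCard c⟩
  have hweight (m : Fin d →₀ ℕ) (hm : m ∈ f.support) : ∑ j, pWeight p (m j) = n := by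
    rw [← (hsupp m hm).2]
    exact Finset.sum_congr rfl fun j _ => pWeight_of_lt ((hsupp m hm).1 j)
  have hTD : InTD p n fun a => eval a f := by
    refine ⟨f, fun m hm j => ((hsupp m hm).1 j).trans_le le_card_of_charP, fun _ => rfl,
      fun m hm => (hweight m hm).le, fun m hm _ => (hsupp m hm).1, fun m hm => ?_⟩
    rw [Finsupp.sum_fintype _ _ fun _ => rfl, (hsupp m hm).2]
    exact ⟨NeZero.pos n, Nat.ModEq.refl n⟩
  refine ⟨_, hTD, (hTD.isCharSymNLinear_fnDefect hp).eq_of_single hφ fun c => ?_⟩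
  have hadm (m : Fin d →₀ ℕ) (hm : m ∈ f.support) : AdmissibleExponent p n m := by
    refine ⟨?_, (hweight m hm).le, fun _ => (hsupp m hm).1⟩
    rintro rfl
    exact NeZero.ne n (by simpa using (hsupp 0 hm).2.symm)
  rw [fnDefect_single hp (fun _ => rfl) hadm c]
  by_cases hc : ∀ j, fiberCard c j < p
  · have hmem : expo c ∈ s := Finset.mem_filter.mpr ⟨by simp, hc⟩
    change coeff (expo c) f * _ = _
    rw [hcoeff, if_pos hmem, hvalue]
    exact inv_mul_cancel_right₀ (prod_factorial_ne_zero hp hc) _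
  · push Not at hc
    obtain ⟨j, hj⟩ := hc
    rw [prod_factorial_eq_zero hp hj, mul_zero, hφ.single_eq_zero hp hj]

end FiniteField

/-- the correspondence: over a finite field `F` of characteristic `p` with
`q` elements, the polarization map `α ↦ Δ^n α` is an `F`-linear map from `T∩D` onto the
space of characteristic symmetric `n`-linear forms `V^n → F` (`V = F^d`); its kernel
consists exactly of those `α ∈ T∩D` whose reduced representative has all monomials of
`p`-degree at most `n − 1`, and two elements of `T∩D` have the same image iff their
difference lies in this kernel, so that the space of characteristic symmetric `n`-linear
forms is isomorphic to the quotient of `T∩D` by the kernel. -/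
theorem polarization_correspondence
    {F : Type*} [Field F] [Fintype F] {p : ℕ} [CharP F p] (hp : p.Prime)
    (d n : ℕ) (hn : 1 ≤ n) :
    -- `F`-linearity of the polarization map on `T∩D`
    (∀ α β : (Fin d → F) → F, InTD p n α → InTD p n β →
      fnDefect (α + β) n = fnDefect α n + fnDefect β n) ∧
    (∀ (α : (Fin d → F) → F) (c : F), InTD p n α →
      fnDefect (c • α) n = c • fnDefect α n) ∧
    -- it maps `T∩D` into the characteristic symmetric `n`-linear forms
    (∀ α : (Fin d → F) → F, InTD p n α → IsCharSymNLinear p n (fnDefect α n)) ∧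
    -- it maps `T∩D` onto the characteristic symmetric `n`-linear forms
    (∀ φ : (Fin n → (Fin d → F)) → F, IsCharSymNLinear p n φ →
      ∃ α : (Fin d → F) → F, InTD p n α ∧ fnDefect α n = φ) ∧
    -- its kernel consists of the `α ∈ T∩D` of combinatorial degree at most `n − 1`,
    -- i.e. whose reduced representative has all monomials of `p`-degree `≤ n − 1`
    (∀ α : (Fin d → F) → F, InTD p n α →
      (fnDefect α n = 0 ↔
        ∀ f : MvPolynomial (Fin d) F, Reduced f → (∀ a, MvPolynomial.eval a f = α a) →
          ∀ m ∈ f.support, (∑ j, pWeight p (m j)) ≤ n - 1)) ∧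
    -- consequently, two elements of `T∩D` polarize to the same form iff their
    -- difference lies in the kernel (first isomorphism theorem content)
    (∀ α β : (Fin d → F) → F, InTD p n α → InTD p n β →
      (fnDefect α n = fnDefect β n ↔
        ∀ f : MvPolynomial (Fin d) F, Reduced f →
          (∀ a, MvPolynomial.eval a f = (α - β) a) →
          ∀ m ∈ f.support, (∑ j, pWeight p (m j)) ≤ n - 1)) := by
  have : NeZero n := ⟨Nat.one_le_iff_ne_zero.mp hn⟩
  refine ⟨fun α β _ _ => map_add (fnDefectLinear F _ n) α β,
    fun α c _ => map_smul (fnDefectLinear F _ n) c α,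
    fun α hα => hα.isCharSymNLinear_fnDefect hp,
    fun φ hφ => hφ.exists_fnDefect_eq hp,
    fun α hα => hα.fnDefect_eq_zero_iff hp,
    fun α β hα hβ => ?_⟩
  rw [← (hα.sub hβ).fnDefect_eq_zero_iff hp, ← fnDefectLinear_apply n (α - β), map_sub,
    sub_eq_zero]
  rfl
end
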